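/- Let 0<α<1/2, β>2α and σ>2α. Let Ω ⊆ ℝ² be a bounded domain whose boundary is a simple closed curve admitting an L-periodic unit-speed parametrization with β-Hölder tangent, and let γ : ℝ → ℝ² be any 2π-periodic, continuously differentiable parametrization of ∂Ω with σ-Hölder derivative, injective on [0,2π), with g(x) := ‖γ'(x)‖ > 0 everywhere. Set T := γ'/g and ℓ(x) := ∫_0^x g(y) dy. Then for every x, the two principal values lim_{ε→0⁺} ∫_{{y∈[x−π,x+π] : |ℓ(x)−ℓ(y)|≥ε}} T(y)·((γ(x)−γ(y))·T(x))/‖γ(x)−γ(y)‖^{2+2α} · g(y) dy and lim_{ε→0⁺} ∫_{{y∈[x−π,x+π] : g(x)|x−y|≥ε}} T(y)·((γ(x)−γ(y))·T(x))/‖γ(x)−γ(y)‖^{2+2α} · g(y) dy both exist and are equal. -/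

import Mathlib

open MeasureTheory Real Set Function Filter Bornology
open scoped RealInnerProductSpace Topology

noncomputable section

/-- The plane `ℝ²`. -/
abbrev R2 := EuclideanSpace ℝ (Fin 2)

/-- The counterclockwise rotation by 90°: `(a,b)^⊥ = (-b,a)`. -/
def perp (v : R2) : R2 := (WithLp.equiv 2 (Fin 2 → ℝ)).symm ![-(v 1), v 0]

/-- The α-SQG velocity generated by a bounded set `U`:
`v_U(x) = ∫_U (x-y)^⊥ / ‖x-y‖^{2+2α} dy`. -/
def sqgVelocity (α : ℝ) (U : Set R2) (x : R2) : R2 :=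
  ∫ y in U, (‖x - y‖ ^ (2 + 2 * α))⁻¹ • perp (x - y)

/-- `γ` is an `L`-periodic arc-length (unit-speed) parametrization of the set `S`. -/
def IsArcLengthParam (L : ℝ) (γ : ℝ → R2) (S : Set R2) : Prop :=
  0 < L ∧ Periodic γ L ∧ InjOn γ (Ico 0 L) ∧ ContDiff ℝ 1 γ ∧
    (∀ s, ‖deriv γ s‖ = 1) ∧ range γ = S

/-- Unit tangent of a parametrized curve. -/
def tangent1 (γ : ℝ → R2) (x : ℝ) : R2 := (‖deriv γ x‖)⁻¹ • deriv γ x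

/-- The odd kernel `y ↦ (x - y) / |x - y|^{2 + p}`. -/
def oddKernel (p x y : ℝ) : ℝ := (x - y) / |x - y| ^ (2 + p)

theorem measurable_oddKernel (p x : ℝ) : Measurable (oddKernel p x) := by
  unfold oddKernel
  fun_prop

theorem abs_oddKernel {p : ℝ} (hp : 0 < p) (x y : ℝ) :
    |oddKernel p x y| = |x - y| ^ (-(1 + p)) := by
  unfold oddKernel
  rcases eq_or_ne x y with rfl | h
  · rw [sub_self, abs_zero, zero_div, abs_zero, Real.zero_rpow (by linarith)]
  · have h0 : 0 < |x - y| := abs_pos.2 (sub_ne_zero.2 h)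
    rw [abs_div, abs_of_nonneg (Real.rpow_nonneg h0.le _),
      show -(1 + p) = 1 - (2 + p) by ring, Real.rpow_sub h0, Real.rpow_one]

/-- Removing a symmetric neighbourhood of the singularity, the odd kernel integrates to zero. -/
theorem setIntegral_oddKernel_smul_eq_zero {E : Type*} [NormedAddCommGroup E] [NormedSpace ℝ E]
    (p x a g ε : ℝ) (v : E) :
    ∫ y in {y : ℝ | y ∈ Icc (x - a) (x + a) ∧ ε ≤ g * |x - y|}, oddKernel p x y • v = 0 := by
  set S := {y : ℝ | y ∈ Icc (x - a) (x + a) ∧ ε ≤ g * |x - y|} with hS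
  have hSm : MeasurableSet S :=
    measurableSet_Icc.inter (measurableSet_le (f := fun _ => ε) (g := fun y => g * |x - y|)
      measurable_const (by fun_prop))
  rw [← integral_indicator hSm]
  have h := integral_sub_left_eq_self (S.indicator fun y => oddKernel p x y • v) volume (2 * x)
  have hodd : ∀ y, S.indicator (fun y => oddKernel p x y • v) (2 * x - y) =
      -S.indicator (fun y => oddKernel p x y • v) y := by
    intro y
    have hxy : x - (2 * x - y) = -(x - y) := by ring
    have hmem : 2 * x - y ∈ S ↔ y ∈ S := by
      simp only [hS, mem_ofPred_eq, hxy, abs_neg, mem_Icc]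
      constructor <;> rintro ⟨⟨h1, h2⟩, h3⟩ <;> exact ⟨⟨by linarith, by linarith⟩, h3⟩
    by_cases hy : y ∈ S
    · rw [indicator_of_mem hy, indicator_of_mem (hmem.2 hy)]
      simp only [oddKernel, hxy, abs_neg, neg_div, neg_smul]
    · rw [indicator_of_notMem hy, indicator_of_notMem (mt hmem.1 hy), neg_zero]
  simp only [hodd] at h
  rw [integral_neg] at h
  have h2 : (2 : ℝ) • ∫ y, S.indicator (fun y => oddKernel p x y • v) y = 0 := by
    rw [two_smul]
    nth_rw 1 [← h]
    exact neg_add_cancel _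
  exact (smul_eq_zero.1 h2).resolve_left two_ne_zero

theorem integrableOn_abs_sub_rpow {r : ℝ} (hr : -1 < r) (x a : ℝ) :
    IntegrableOn (fun y => |x - y| ^ r) (Icc (x - a) (x + a)) := by
  have hright : IntegrableOn (fun y => |x - y| ^ r) (Icc x (x + a)) := by
    rcases lt_or_ge a 0 with ha | ha
    · rw [Icc_eq_empty (by linarith)]; exact integrableOn_empty
    have h := (intervalIntegral.intervalIntegrable_rpow' (a := 0) (b := a) hr).comp_sub_right x
    rw [intervalIntegrable_iff_integrableOn_Icc_of_le (by linarith)] at h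
    rw [zero_add, add_comm] at h
    refine h.congr_fun (fun y hy => ?_) measurableSet_Icc
    simp only
    rw [abs_sub_comm, abs_of_nonneg (by linarith [hy.1])]
  have hleft : IntegrableOn (fun y => |x - y| ^ r) (Icc (x - a) x) := by
    rcases lt_or_ge a 0 with ha | ha
    · rw [Icc_eq_empty (by linarith)]; exact integrableOn_empty
    have h := (intervalIntegral.intervalIntegrable_rpow' (a := 0) (b := a) hr).comp_sub_left x
    replace h := h.symm
    rw [intervalIntegrable_iff_integrableOn_Icc_of_le (by linarith), sub_zero] at h
    refine h.congr_fun (fun y hy => ?_) measurableSet_Icc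
    simp only
    rw [abs_of_nonneg (by linarith [hy.2])]
  refine (hleft.union hright).mono_set fun y hy => ?_
  rcases le_total y x with h | h
  · exact Or.inl ⟨hy.1, h⟩
  · exact Or.inr ⟨h, hy.2⟩

section PrincipalValue

variable {E : Type*} [NormedAddCommGroup E] [NormedSpace ℝ E] {H : ℝ → E} {Φ : ℝ → ℝ}
  {p σ x a g m M C : ℝ}

theorem norm_oddKernel_smul_le (hp : 0 < p) {y δ N : ℝ} {v : E} (hδ : 0 < δ) (hy : δ ≤ |x - y|)
    (hv : ‖v‖ ≤ N) : ‖oddKernel p x y • v‖ ≤ δ ^ (-(1 + p)) * N := by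
  rw [norm_smul, Real.norm_eq_abs, abs_oddKernel hp]
  exact mul_le_mul (Real.rpow_le_rpow_of_nonpos hδ hy (by linarith)) hv (norm_nonneg _)
    (by positivity)

theorem measurableSet_truncation (hΦ : Measurable Φ) (ε : ℝ) :
    MeasurableSet {y : ℝ | y ∈ Icc (x - a) (x + a) ∧ ε ≤ Φ y} :=
  measurableSet_Icc.inter (measurableSet_le measurable_const hΦ)

theorem integrableOn_oddKernel_smul_truncation (hp : 0 < p)
    (hH : ContinuousOn H (Icc (x - a) (x + a))) (hΦ : Measurable Φ) (hM : 0 < M)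
    (hΦM : ∀ y ∈ Icc (x - a) (x + a), Φ y ≤ M * |x - y|) {ε : ℝ} (hε : 0 < ε) :
    IntegrableOn (fun y => oddKernel p x y • H y)
      {y : ℝ | y ∈ Icc (x - a) (x + a) ∧ ε ≤ Φ y} := by
  obtain ⟨N, hN⟩ := isCompact_Icc.exists_bound_of_continuousOn hH
  have hsub : {y : ℝ | y ∈ Icc (x - a) (x + a) ∧ ε ≤ Φ y} ⊆ Icc (x - a) (x + a) := fun y hy => hy.1
  have hmeas : AEStronglyMeasurable (fun y => oddKernel p x y • H y)
      (volume.restrict {y : ℝ | y ∈ Icc (x - a) (x + a) ∧ ε ≤ Φ y}) :=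
    (measurable_oddKernel p x).aestronglyMeasurable.smul
      ((hH.aestronglyMeasurable measurableSet_Icc).mono_measure
        (Measure.restrict_mono hsub le_rfl))
  refine IntegrableOn.of_bound ((measure_mono hsub).trans_lt (by simp)) hmeas
    ((ε / M) ^ (-(1 + p)) * N) ?_
  refine (ae_restrict_iff' (measurableSet_truncation hΦ ε)).2 (Eventually.of_forall fun y hy => ?_)
  refine norm_oddKernel_smul_le hp (by positivity) ?_ (hN y hy.1)
  rw [div_le_iff₀' hM]
  exact hy.2.trans (hΦM y hy.1)

/-- The symmetric principal value exists for a density that is Hölder continuous at the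
singularity. -/
theorem tendsto_symmetric_truncation (hp : 0 < p) (hσ : p < σ) (hg : 0 < g) (hC : 0 ≤ C)
    (hH : ContinuousOn H (Icc (x - a) (x + a)))
    (hHol : ∀ y ∈ Icc (x - a) (x + a), ‖H y - H x‖ ≤ C * |x - y| ^ σ) :
    Tendsto (fun ε : ℝ => ∫ y in {y : ℝ | y ∈ Icc (x - a) (x + a) ∧ ε ≤ g * |x - y|},
        oddKernel p x y • H y) (𝓝[>] 0)
      (𝓝 (∫ y in Icc (x - a) (x + a), oddKernel p x y • (H y - H x))) := by
  have hΦ : Measurable fun y => g * |x - y| := by fun_prop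
  have key : ∀ ε : ℝ, 0 < ε →
      ∫ y in {y : ℝ | y ∈ Icc (x - a) (x + a) ∧ ε ≤ g * |x - y|}, oddKernel p x y • H y =
      ∫ y in Icc (x - a) (x + a), {y : ℝ | ε ≤ g * |x - y|}.indicator
        (fun y => oddKernel p x y • (H y - H x)) y := by
    intro ε hε
    rw [setIntegral_indicator (measurableSet_le measurable_const hΦ)]
    simp only [smul_sub]
    have h := integral_sub
      (integrableOn_oddKernel_smul_truncation hp hH hΦ hg (fun y _ => le_rfl) hε)
      (integrableOn_oddKernel_smul_truncation (H := fun _ => H x) hp continuousOn_const hΦ hg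
        (fun y _ => le_rfl) hε)
    rw [setIntegral_oddKernel_smul_eq_zero, sub_zero] at h
    exact h.symm
  refine Tendsto.congr' (f₁ := fun ε => ∫ y in Icc (x - a) (x + a),
    {y : ℝ | ε ≤ g * |x - y|}.indicator (fun y => oddKernel p x y • (H y - H x)) y) ?_ ?_
  · filter_upwards [self_mem_nhdsWithin] with ε hε using (key ε hε).symm
  have hmeas : AEStronglyMeasurable (fun y => oddKernel p x y • (H y - H x))
      (volume.restrict (Icc (x - a) (x + a))) :=
    (measurable_oddKernel p x).aestronglyMeasurable.smul
      ((hH.sub continuousOn_const).aestronglyMeasurable measurableSet_Icc)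
  refine tendsto_integral_filter_of_dominated_convergence
    (fun y => C * |x - y| ^ (σ - (1 + p))) ?_ ?_ ?_ ?_
  · exact Eventually.of_forall fun ε => hmeas.indicator (measurableSet_le measurable_const hΦ)
  · refine Eventually.of_forall fun ε => (ae_restrict_iff' measurableSet_Icc).2 ?_
    refine Eventually.of_forall fun y hy => (norm_indicator_le_norm_self _ _).trans ?_
    rw [norm_smul, Real.norm_eq_abs, abs_oddKernel hp]
    rcases eq_or_ne x y with rfl | hxy
    · rw [sub_self, abs_zero, Real.zero_rpow (by linarith : -(1 + p) ≠ 0), zero_mul]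
      positivity
    · have h0 : 0 < |x - y| := abs_pos.2 (sub_ne_zero.2 hxy)
      rw [sub_eq_add_neg σ, Real.rpow_add h0]
      calc _ ≤ |x - y| ^ (-(1 + p)) * (C * |x - y| ^ σ) := by gcongr; exact hHol y hy
        _ = _ := by ring
  · exact (integrableOn_abs_sub_rpow (by linarith) x a).const_mul C
  · refine Eventually.of_forall fun y => ?_
    rcases eq_or_ne x y with rfl | hxy
    · simp [indicator]
    · refine tendsto_const_nhds.congr' ?_
      have h0 : 0 < g * |x - y| := mul_pos hg (abs_pos.2 (sub_ne_zero.2 hxy))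
      filter_upwards [Ioo_mem_nhdsGT h0] with ε hε
      exact (indicator_of_mem (s := {y : ℝ | ε ≤ g * |x - y|}) hε.2.le
        (fun y => oddKernel p x y • (H y - H x))).symm

theorem norm_setIntegral_oddKernel_smul_le (hp : 0 < p) {N w δ ε : ℝ} {s : Set ℝ} (hg : 0 < g)
    (hδ : 0 < δ) (hw : 0 ≤ w) (hN : 0 ≤ N)
    (hs : ∀ y ∈ s, δ ≤ |x - y| ∧ |(g * |x - y|) - ε| ≤ w ∧ ‖H y‖ ≤ N) :
    ‖∫ y in s, oddKernel p x y • H y‖ ≤ δ ^ (-(1 + p)) * N * (4 * w / g) := by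
  have hsub : s ⊆ Icc (x + (ε - w) / g) (x + (ε + w) / g) ∪
      Icc (x - (ε + w) / g) (x - (ε - w) / g) := by
    intro y hy
    obtain ⟨-, h, -⟩ := hs y hy
    rw [abs_le] at h
    have h1 : (ε - w) / g ≤ |x - y| := by rw [div_le_iff₀' hg]; linarith
    have h2 : |x - y| ≤ (ε + w) / g := by rw [le_div_iff₀' hg]; linarith
    rcases le_total y x with hyx | hyx
    · rw [abs_of_nonneg (by linarith)] at h1 h2
      exact Or.inr ⟨by linarith, by linarith⟩
    · rw [abs_of_nonpos (by linarith)] at h1 h2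
      exact Or.inl ⟨by linarith, by linarith⟩
  have hlen : 0 ≤ 2 * w / g := by positivity
  have hvol : volume s ≤ ENNReal.ofReal (4 * w / g) := by
    refine (measure_mono hsub).trans ((measure_union_le _ _).trans ?_)
    rw [Real.volume_Icc, Real.volume_Icc,
      show x + (ε + w) / g - (x + (ε - w) / g) = 2 * w / g by ring,
      show x - (ε - w) / g - (x - (ε + w) / g) = 2 * w / g by ring,
      ← ENNReal.ofReal_add hlen hlen]
    exact ENNReal.ofReal_le_ofReal (by ring_nf; rfl)
  refine (norm_setIntegral_le_of_norm_le_const (hvol.trans_lt ENNReal.ofReal_lt_top)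
    fun y hy => norm_oddKernel_smul_le hp hδ (hs y hy).1 (hs y hy).2.2).trans ?_
  gcongr
  exact ENNReal.toReal_le_of_le_ofReal (by positivity) hvol

/-- Truncating with a gauge `Φ` that agrees with `g |x - y|` up to order `1 + σ` gives the same
principal value as truncating with `g |x - y|`. -/
theorem tendsto_truncation_sub (hp : 0 < p) (hσ : p < σ) (hm : 0 < m) (hmg : m ≤ g) (hgM : g ≤ M)
    (hC : 0 ≤ C) (hH : ContinuousOn H (Icc (x - a) (x + a))) (hΦ : Measurable Φ)
    (hΦm : ∀ y ∈ Icc (x - a) (x + a), m * |x - y| ≤ Φ y)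
    (hΦM : ∀ y ∈ Icc (x - a) (x + a), Φ y ≤ M * |x - y|)
    (hΦg : ∀ y ∈ Icc (x - a) (x + a), |(Φ y - g * |x - y|)| ≤ C * |x - y| ^ (1 + σ)) :
    Tendsto (fun ε : ℝ =>
        (∫ y in {y : ℝ | y ∈ Icc (x - a) (x + a) ∧ ε ≤ Φ y}, oddKernel p x y • H y) -
        ∫ y in {y : ℝ | y ∈ Icc (x - a) (x + a) ∧ ε ≤ g * |x - y|}, oddKernel p x y • H y)
      (𝓝[>] 0) (𝓝 0) := by
  have hg : 0 < g := hm.trans_le hmg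
  have hM : 0 < M := hg.trans_le hgM
  obtain ⟨N', hN'⟩ := isCompact_Icc.exists_bound_of_continuousOn hH
  obtain ⟨N, hN0, hN⟩ : ∃ N, 0 ≤ N ∧ ∀ y ∈ Icc (x - a) (x + a), ‖H y‖ ≤ N :=
    ⟨max N' 0, le_max_right _ _, fun y hy => (hN' y hy).trans (le_max_left _ _)⟩
  have hΨ : Measurable fun y => g * |x - y| := by fun_prop
  have hband : ∀ ε : ℝ, 0 < ε → ∀ y ∈ Icc (x - a) (x + a),
      (ε ≤ Φ y ∧ ¬ ε ≤ g * |x - y| ∨ ε ≤ g * |x - y| ∧ ¬ ε ≤ Φ y) →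
      ε / M ≤ |x - y| ∧ |(g * |x - y|) - ε| ≤ C * (ε / m) ^ (1 + σ) ∧ ‖H y‖ ≤ N := by
    intro ε hε y hy h
    have hr := abs_nonneg (x - y)
    have hlow := hΦm y hy
    have hupp := hΦM y hy
    have hdist := hΦg y hy
    have hmg' : m * |x - y| ≤ g * |x - y| := by gcongr
    have hgM' : g * |x - y| ≤ M * |x - y| := by gcongr
    have hle : |x - y| ≤ ε / m := by
      rw [le_div_iff₀' hm]
      rcases h with h | h <;> linarith [h.1, not_le.1 h.2]
    refine ⟨?_, ?_, hN y hy⟩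
    · rw [div_le_iff₀' hM]
      rcases h with h | h <;> linarith [h.1]
    · have h1 : C * |x - y| ^ (1 + σ) ≤ C * (ε / m) ^ (1 + σ) := by
        gcongr
        linarith
      rw [abs_le] at hdist ⊢
      rcases h with h | h <;> constructor <;> linarith [h.1, not_le.1 h.2]
  set c := 2 * ((M⁻¹) ^ (-(1 + p)) * N * (4 * (C * (m⁻¹) ^ (1 + σ)) / g)) with hc
  have hlim : Tendsto (fun ε : ℝ => c * ε ^ (σ - p)) (𝓝[>] 0) (𝓝 0) := by
    have h := ((Real.continuousAt_rpow_const 0 (σ - p) (Or.inr (by linarith))).tendsto.const_mul c)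
    rw [Real.zero_rpow (by linarith), mul_zero] at h
    exact h.mono_left nhdsWithin_le_nhds
  refine squeeze_zero_norm' ?_ hlim
  filter_upwards [self_mem_nhdsWithin] with ε (hε : 0 < ε)
  set U := {y : ℝ | y ∈ Icc (x - a) (x + a) ∧ ε ≤ Φ y}
  set V := {y : ℝ | y ∈ Icc (x - a) (x + a) ∧ ε ≤ g * |x - y|}
  have hw : 0 ≤ C * (ε / m) ^ (1 + σ) := by positivity
  have hδ : 0 < ε / M := by positivity
  have hUV := norm_setIntegral_oddKernel_smul_le (s := U \ V) (H := H) hp hg hδ hw hN0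
    fun y hy => hband ε hε y hy.1.1 (Or.inl ⟨hy.1.2, fun h => hy.2 ⟨hy.1.1, h⟩⟩)
  have hVU := norm_setIntegral_oddKernel_smul_le (s := V \ U) (H := H) hp hg hδ hw hN0
    fun y hy => hband ε hε y hy.1.1 (Or.inr ⟨hy.1.2, fun h => hy.2 ⟨hy.1.1, h⟩⟩)
  rw [← integral_inter_add_sdiff (measurableSet_truncation hΨ ε : MeasurableSet V)
      (integrableOn_oddKernel_smul_truncation hp hH hΦ hM hΦM hε),
    ← integral_inter_add_sdiff (measurableSet_truncation hΦ ε : MeasurableSet U)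
      (integrableOn_oddKernel_smul_truncation hp hH hΨ hg (fun y _ => le_rfl) hε),
    inter_comm V U, add_sub_add_left_eq_sub]
  have hsplit : ε ^ (σ - p) = ε ^ (-(1 + p)) * ε ^ (1 + σ) := by
    rw [← Real.rpow_add hε]
    ring_nf
  refine (norm_sub_le _ _).trans ((add_le_add hUV hVU).trans_eq ?_)
  rw [hc, div_eq_mul_inv ε M, div_eq_mul_inv ε m, Real.mul_rpow hε.le (by positivity),
    Real.mul_rpow hε.le (by positivity), hsplit]
  ring

end PrincipalValue

section Curve

variable {E : Type*} [NormedAddCommGroup E] {σ B : ℝ}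

theorem norm_sub_le_of_holder_deriv_uIcc {f : ℝ → E} (hσ : 0 ≤ σ) (hB : 0 ≤ B)
    (h : ∀ x y : ℝ, ‖f x - f y‖ ≤ B * |x - y| ^ σ) {x y t : ℝ} (ht : t ∈ uIcc x y) :
    ‖f t - f x‖ ≤ B * |x - y| ^ σ := by
  refine (h t x).trans ?_
  have : |t - x| ≤ |x - y| := by
    rw [abs_sub_comm x y]
    exact abs_sub_left_of_mem_uIcc ht
  gcongr

/-- A Hölder derivative controls the difference quotient. -/
theorem norm_dslope_sub_deriv_le [NormedSpace ℝ E] {γ : ℝ → E} (hd : Differentiable ℝ γ)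
    (hσ : 0 ≤ σ) (hB : 0 ≤ B) (h : ∀ x y : ℝ, ‖deriv γ x - deriv γ y‖ ≤ B * |x - y| ^ σ)
    (x y : ℝ) : ‖dslope γ x y - deriv γ x‖ ≤ B * |x - y| ^ σ := by
  rcases eq_or_ne y x with rfl | hxy
  · rw [dslope_same, sub_self, norm_zero]
    positivity
  · have hmv := (convex_uIcc x y).norm_image_sub_le_of_norm_hasDerivWithin_le
      (f := fun t => γ t - t • deriv γ x) (f' := fun t => deriv γ t - (1 : ℝ) • deriv γ x)
      (C := B * |x - y| ^ σ)
      (fun t _ => ((hd t).hasDerivAt.sub ((hasDerivAt_id t).smul_const _)).hasDerivWithinAt)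
      (fun t ht => by
        rw [one_smul]
        exact norm_sub_le_of_holder_deriv_uIcc hσ hB h ht) left_mem_uIcc right_mem_uIcc
    have h0 : 0 < ‖y - x‖ := norm_pos_iff.2 (sub_ne_zero.2 hxy)
    have heq : γ y - y • deriv γ x - (γ x - x • deriv γ x) =
        (y - x) • (dslope γ x y - deriv γ x) := by
      rw [smul_sub, sub_smul_dslope, sub_smul]
      abel
    rw [heq, norm_smul, mul_comm] at hmv
    exact le_of_mul_le_mul_right hmv h0

theorem abs_integral_sub_mul_le {f : ℝ → ℝ} (hf : Continuous f) (hσ : 0 < σ) (hB : 0 ≤ B)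
    (h : ∀ x y : ℝ, ‖f x - f y‖ ≤ B * |x - y| ^ σ) (x y : ℝ) :
    |(∫ u in y..x, f u) - (x - y) * f x| ≤ B * |x - y| ^ (1 + σ) := by
  have h1 : (∫ u in y..x, f u) - (x - y) * f x = ∫ u in y..x, (f u - f x) := by
    rw [intervalIntegral.integral_sub (hf.intervalIntegrable _ _) (by simp)]
    simp
  rw [h1, Real.rpow_one_add' (abs_nonneg _) (by linarith), mul_comm |x - y|, ← mul_assoc]
  rw [← Real.norm_eq_abs]
  refine intervalIntegral.norm_integral_le_of_norm_le_const fun u hu => ?_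
  refine norm_sub_le_of_holder_deriv_uIcc hσ.le hB h ?_
  rw [uIcc_comm]
  exact uIoc_subset_uIcc hu

theorem mul_abs_sub_le_abs_integral {f : ℝ → ℝ} (hf : Continuous f) {m x y : ℝ}
    (h : ∀ u ∈ uIcc y x, m ≤ f u) : m * |x - y| ≤ |∫ u in y..x, f u| := by
  wlog hyx : y ≤ x generalizing x y
  · rw [abs_sub_comm, intervalIntegral.integral_symm, abs_neg]
    exact this (by rwa [uIcc_comm]) (le_of_not_ge hyx)
  rw [uIcc_of_le hyx] at h
  have hmono := intervalIntegral.integral_mono_on (μ := volume) hyx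
    intervalIntegrable_const (hf.intervalIntegrable y x) h
  (conv at hmono => enter [1]; rw [intervalIntegral.integral_const, smul_eq_mul])
  rw [abs_of_nonneg (sub_nonneg.2 hyx), mul_comm]
  exact hmono.trans (le_abs_self _)

end Curve

/-- A simple closed curve does not return to `γ x` within half a period. -/
theorem ne_of_mem_Icc_of_injOn_Ico {X : Type*} {γ : ℝ → X} {P : ℝ} (hP : 0 < P)
    (hper : Periodic γ P) (hinj : InjOn γ (Ico 0 P)) {x y : ℝ}
    (hy : y ∈ Icc (x - P / 2) (x + P / 2)) (hne : y ≠ x) : γ y ≠ γ x := by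
  intro h
  have hmod : ∀ z, γ (toIcoMod hP 0 z) = γ z := fun z => hper.sub_zsmul_eq _
  have hmem : ∀ z, toIcoMod hP 0 z ∈ Ico 0 P := fun z => by
    simpa using toIcoMod_mem_Ico hP 0 z
  have h2 := hinj (hmem y) (hmem x) (by rw [hmod, hmod, h])
  obtain ⟨n, hn⟩ : ∃ n : ℤ, y - x = n * P := by
    refine ⟨toIcoDiv hP 0 y - toIcoDiv hP 0 x, ?_⟩
    simp only [toIcoMod, zsmul_eq_mul] at h2
    push_cast
    linarith
  have hn1 : (n : ℝ) < 1 := by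
    by_contra! hge
    nlinarith [hy.2]
  have hn2 : (-1 : ℝ) < n := by
    by_contra! hle
    nlinarith [hy.1]
  have hn0 : n = 0 := by
    have h1 : n < 1 := by exact_mod_cast hn1
    have h3 : -1 < n := by exact_mod_cast hn2
    omega
  rw [hn0, Int.cast_zero, zero_mul] at hn
  exact hne (sub_eq_zero.1 hn)

/-- A Hölder bound near `x` extends to any compact set on which the function is continuous. -/
theorem exists_holder_bound_of_isBigO {E : Type*} [NormedAddCommGroup E] {H : ℝ → E} {x σ : ℝ}
    {K : Set ℝ} (hK : IsCompact K) (hH : ContinuousOn H K) (hσ : 0 < σ)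
    (h : (fun y => H y - H x) =O[𝓝 x] fun y => |x - y| ^ σ) :
    ∃ C, 0 ≤ C ∧ ∀ y ∈ K, ‖H y - H x‖ ≤ C * |x - y| ^ σ := by
  obtain ⟨c, hc0, hc⟩ := h.exists_nonneg
  rw [Asymptotics.IsBigOWith, Metric.eventually_nhds_iff] at hc
  obtain ⟨δ, hδ, hc⟩ := hc
  obtain ⟨N, hN⟩ := hK.exists_bound_of_continuousOn (hH.sub continuousOn_const)
  refine ⟨max c (N / δ ^ σ), le_max_of_le_left hc0, fun y hy => ?_⟩
  have hpow : 0 ≤ |x - y| ^ σ := by positivity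
  rcases lt_or_ge |x - y| δ with hlt | hge
  · have := hc (y := y) (by rwa [Real.dist_eq, abs_sub_comm])
    rw [Real.norm_of_nonneg hpow] at this
    exact this.trans (by gcongr; exact le_max_left _ _)
  · have hN0 : 0 ≤ N := (norm_nonneg _).trans (hN y hy)
    have hδσ : 0 < δ ^ σ := by positivity
    calc ‖H y - H x‖ ≤ N := hN y hy
      _ = N / δ ^ σ * δ ^ σ := by field_simp
      _ ≤ max c (N / δ ^ σ) * |x - y| ^ σ := by
        gcongr
        exact le_max_right _ _

/-- **Lemma 3.4 (equality of two principal values)**: for a `C^{1,σ}` parametrization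
`γ` (with `σ > 2α`) of the boundary of a `C^{1,β}` domain (`β > 2α`), the principal
values of `∫ T(y) (γ(x)-γ(y))·T(x)/‖γ(x)-γ(y)‖^{2+2α} g(y) dy` defined by removing
`{|ℓ(x)-ℓ(y)| < ε}` and by removing `{g(x)|x-y| < ε}` both exist and coincide. -/
theorem principal_values_agree (α β σ A B L : ℝ) (hα0 : 0 < α) (hα : α < 1/2)
    (hβ : 2 * α < β) (hσ : 2 * α < σ)
    (Ω : Set R2) (hO : IsOpen Ω) (hB : IsBounded Ω) (hC : IsConnected Ω)
    (η : ℝ → R2) (hη : IsArcLengthParam L η (frontier Ω))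
    (hηHol : ∀ s s' : ℝ, ‖deriv η s - deriv η s'‖ ≤ A * |s - s'| ^ β)
    (γ : ℝ → R2) (hper : Periodic γ (2 * π)) (hC1 : ContDiff ℝ 1 γ)
    (hinj : InjOn γ (Ico 0 (2 * π))) (hrange : range γ = frontier Ω)
    (hpos : ∀ x, 0 < ‖deriv γ x‖)
    (hγHol : ∀ x y : ℝ, ‖deriv γ x - deriv γ y‖ ≤ B * |x - y| ^ σ) :
    ∀ x : ℝ, ∃ I : R2,
      Tendsto (fun ε : ℝ => ∫ y in {y : ℝ | y ∈ Icc (x - π) (x + π) ∧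
          ε ≤ |(∫ u in (0:ℝ)..x, ‖deriv γ u‖) - ∫ u in (0:ℝ)..y, ‖deriv γ u‖|},
          ((⟪γ x - γ y, tangent1 γ x⟫ / ‖γ x - γ y‖ ^ (2 + 2 * α)) * ‖deriv γ y‖) •
            tangent1 γ y)
        (𝓝[>] (0:ℝ)) (𝓝 I) ∧
      Tendsto (fun ε : ℝ => ∫ y in {y : ℝ | y ∈ Icc (x - π) (x + π) ∧
          ε ≤ ‖deriv γ x‖ * |x - y|},
          ((⟪γ x - γ y, tangent1 γ x⟫ / ‖γ x - γ y‖ ^ (2 + 2 * α)) * ‖deriv γ y‖) •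
            tangent1 γ y)
        (𝓝[>] (0:ℝ)) (𝓝 I) := by
  intro x
  have hπ := Real.pi_pos
  set K := Icc (x - π) (x + π) with hK
  have hσ0 : 0 < σ := by linarith
  have hB0 : 0 ≤ B := by
    have h := (norm_nonneg _).trans (hγHol 1 0)
    simpa using h
  have hd : Differentiable ℝ γ := hC1.differentiable (by norm_num)
  have hdc : Continuous (deriv γ) := hC1.continuous_deriv (by norm_num)
  have hgc : Continuous fun u => ‖deriv γ u‖ := hdc.norm
  have hgHol : ∀ u v : ℝ, ‖‖deriv γ u‖ - ‖deriv γ v‖‖ ≤ B * |u - v| ^ σ := fun u v =>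
    (abs_norm_sub_norm_le _ _).trans (hγHol u v)
  have hxK : x ∈ K := ⟨by linarith, by linarith⟩
  set q := dslope γ x with hq
  have hqc : Continuous q := by
    rw [← continuousOn_univ]
    exact (continuousOn_dslope univ_mem).2 ⟨hd.continuous.continuousOn, hd x⟩
  have hq0 : ∀ y ∈ K, q y ≠ 0 := by
    intro y hy h0
    rcases eq_or_ne y x with rfl | hne
    · rw [hq, dslope_same] at h0
      exact (hpos y).ne' (by rw [h0, norm_zero])
    · have h := sub_smul_dslope γ x y
      rw [← hq, h0, smul_zero] at h
      refine ne_of_mem_Icc_of_injOn_Ico (by positivity) hper hinj ?_ hne (sub_eq_zero.1 h.symm)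
      rwa [mul_div_cancel_left₀ _ two_ne_zero]
  set F : R2 × R2 → R2 := fun z =>
    (⟪z.1, tangent1 γ x⟫ / ‖z.1‖ ^ (2 + 2 * α)) • z.2 with hF
  have hFd : ∀ z : R2 × R2, z.1 ≠ 0 → DifferentiableAt ℝ F z := by
    intro z hz
    have h1 : DifferentiableAt ℝ (fun z : R2 × R2 => ‖z.1‖) z := differentiableAt_fst.norm ℝ hz
    have h2 : DifferentiableAt ℝ (fun z : R2 × R2 => ⟪z.1, tangent1 γ x⟫) z :=
      differentiableAt_fst.inner ℝ (differentiableAt_const _)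
    have h3 : ‖z.1‖ ^ (2 + 2 * α) ≠ 0 := (Real.rpow_pos_of_pos (norm_pos_iff.2 hz) _).ne'
    have h4 : DifferentiableAt ℝ (fun z : R2 × R2 => ‖z.1‖ ^ (2 + 2 * α)) z :=
      h1.rpow_const (Or.inl (norm_ne_zero_iff.2 hz))
    have h5 : DifferentiableAt ℝ
        (fun z : R2 × R2 => ⟪z.1, tangent1 γ x⟫ / ‖z.1‖ ^ (2 + 2 * α)) z := by
      simp only [div_eq_mul_inv]
      exact h2.mul (h4.inv h3)
    exact h5.smul differentiableAt_snd
  set H : ℝ → R2 := fun y => F (q y, deriv γ y) with hH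
  have hHc : ContinuousOn H K := fun y hy =>
    ((hFd (q y, deriv γ y) (hq0 y hy)).continuousAt.comp
      (f := fun y => (q y, deriv γ y)) (hqc.prodMk hdc).continuousAt).continuousWithinAt
  have hpair : (fun y => (q y, deriv γ y) - (q x, deriv γ x)) =O[𝓝 x] fun y => |x - y| ^ σ := by
    refine Asymptotics.IsBigO.of_bound B (Eventually.of_forall fun y => ?_)
    rw [Real.norm_of_nonneg (by positivity), Prod.mk_sub_mk, Prod.norm_mk]
    refine max_le ?_ ?_
    · rw [hq, dslope_same]
      exact norm_dslope_sub_deriv_le hd hσ0.le hB0 hγHol x y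
    · rw [norm_sub_rev]
      exact hγHol x y
  have hHO : (fun y => H y - H x) =O[𝓝 x] fun y => |x - y| ^ σ :=
    ((hFd (q x, deriv γ x) (hq0 x hxK)).isBigO_sub.comp_tendsto
      (hqc.prodMk hdc).continuousAt).trans hpair
  obtain ⟨C, hC0, hHol⟩ := exists_holder_bound_of_isBigO isCompact_Icc hHc hσ0 hHO
  have hint : (fun y => ((⟪γ x - γ y, tangent1 γ x⟫ / ‖γ x - γ y‖ ^ (2 + 2 * α)) *
      ‖deriv γ y‖) • tangent1 γ y) = fun y => oddKernel (2 * α) x y • H y := by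
    funext y
    have hchord : γ x - γ y = (x - y) • q y := by
      rw [← neg_sub (γ y), ← sub_smul_dslope, ← neg_smul, neg_sub]
    rw [hchord, real_inner_smul_left, norm_smul, Real.norm_eq_abs,
      Real.mul_rpow (abs_nonneg _) (norm_nonneg _), mul_smul _ ‖deriv γ y‖,
      show ‖deriv γ y‖ • tangent1 γ y = deriv γ y from smul_inv_smul₀ (hpos y).ne' _]
    simp only [hH, hF, oddKernel, smul_smul, mul_div_mul_comm]
  have hℓ : ∀ y, (∫ u in (0:ℝ)..x, ‖deriv γ u‖) - ∫ u in (0:ℝ)..y, ‖deriv γ u‖ =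
      ∫ u in y..x, ‖deriv γ u‖ := fun y =>
    intervalIntegral.integral_interval_sub_left (hgc.intervalIntegrable _ _)
      (hgc.intervalIntegrable _ _)
  simp only [hint, hℓ]
  obtain ⟨t, -, ht⟩ := isCompact_Icc.exists_isMinOn ⟨x, hxK⟩ hgc.continuousOn
  obtain ⟨s, -, hs⟩ := isCompact_Icc.exists_isMaxOn ⟨x, hxK⟩ hgc.continuousOn
  have hsub : ∀ y ∈ K, uIcc y x ⊆ K := fun y hy => uIcc_subset_Icc hy hxK
  have hΦ : Measurable fun y => |∫ u in y..x, ‖deriv γ u‖| := by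
    have : Continuous fun y => ∫ u in y..x, ‖deriv γ u‖ := by
      rw [show (fun y => ∫ u in y..x, ‖deriv γ u‖) = _ from funext fun y => (hℓ y).symm]
      exact continuous_const.sub (intervalIntegral.continuous_primitive
        (fun a b => hgc.intervalIntegrable a b) 0)
    exact this.abs.measurable
  have hsym := tendsto_symmetric_truncation (p := 2 * α) (by linarith) hσ (hpos x) hC0 hHc hHol
  have hdiff := tendsto_truncation_sub (p := 2 * α) (m := ‖deriv γ t‖) (M := ‖deriv γ s‖)
    (by linarith) hσ (hpos t) (ht hxK) (hs hxK)
    hB0 hHc hΦ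
    (fun y hy => mul_abs_sub_le_abs_integral hgc fun u hu => ht (hsub y hy hu))
    (fun y hy => intervalIntegral.norm_integral_le_of_norm_le_const fun u hu =>
      (norm_norm _).trans_le (hs (hsub y hy (uIoc_subset_uIcc hu))))
    (fun y _ => by
      have h := abs_integral_sub_mul_le hgc hσ0 hB0 hgHol x y
      have h0 : |(x - y) * ‖deriv γ x‖| = ‖deriv γ x‖ * |x - y| := by
        rw [abs_mul, abs_norm, mul_comm]
      rw [← h0]
      exact (abs_abs_sub_abs_le_abs_sub _ _).trans h)
  refine ⟨_, ?_, hsym⟩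
  have hadd := hdiff.add hsym
  simp only [sub_add_cancel, zero_add] at hadd
  exact hadd
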